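/- Let x ∈ ℝ^p and y ∈ ℝ^q be random vectors such that (x, y) has a joint pdf with continuous one-dimensional marginal cdfs, with mutual information I(y; x), and let P_{u_x}, P_{u_y}, P_{u_{x,y}} be the laws of the copula-uniform dual representations of x, y and (x, y), each with finite differential entropy. Let φ_x, φ_y and φ_{xy} be bounded continuous vector-valued constraint functions (on [0,1]^p, [0,1]^q and [0,1]^{p+q} respectively) each with first coordinate the constant 1, and let P_AM^x, P_AM^y, P_AM^{xy} be the unique maximizers of differential entropy over all absolutely continuous probability measures on the respective cubes subject to E[φ_x] = E_{P_{u_x}}[φ_x], E[φ_y] = E_{P_{u_y}}[φ_y], and E[φ_{xy}] = E_{P_{u_{x,y}}}[φ_{xy}]. Define I_AM(y; x) := h(P_AM^x) + h(P_AM^y) − h(P_AM^{xy}). Then I_AM(y; x) − I(y; x) = KL(P_{u_x} ‖ P_AM^x) + KL(P_{u_y} ‖ P_AM^y) − KL(P_{u_{x,y}} ‖ P_AM^{xy}). -/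

import Mathlib

open MeasureTheory Real Set Filter

noncomputable section
open scoped Classical

/-- The unit cube `[0,1]^d`. -/
def Cube (d : ℕ) : Set (Fin d → ℝ) := Set.univ.pi fun _ => Set.Icc (0:ℝ) 1

/-- The uniform distribution on `[0,1]`. -/
def unif01 : Measure ℝ := volume.restrict (Set.Icc (0:ℝ) 1)

/-- A copula distribution on `[0,1]^d`: a probability measure supported on the cube,
absolutely continuous w.r.t. Lebesgue measure, with uniform one-dimensional marginals. -/
structure IsCopula {d : ℕ} (P : Measure (Fin d → ℝ)) : Prop where
  prob : IsProbabilityMeasure P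
  ac : P ≪ volume
  mass : P (Cube d) = 1
  marg : ∀ i : Fin d, P.map (fun u => u i) = unif01

/-- Lebesgue density of a measure. -/
def dens {α : Type*} [MeasureSpace α] (P : Measure α) : α → ℝ :=
  fun x => (P.rnDeriv volume x).toReal

/-- Differential entropy `-∫ p log p` (w.r.t. Lebesgue measure). -/
def diffEnt {α : Type*} [MeasureSpace α] (P : Measure α) : ℝ :=
  - ∫ x, dens P x * Real.log (dens P x)

/-- The differential entropy of `P` exists and is finite. -/
def FiniteEnt {α : Type*} [MeasureSpace α] (P : Measure α) : Prop :=
  Integrable (fun x => dens P x * Real.log (dens P x))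

/-- Kullback-Leibler divergence `KL(P ‖ Q)`, valued in `EReal`. -/
def klDiv {α : Type*} [MeasurableSpace α] (P Q : Measure α) : EReal :=
  if P ≪ Q ∧ Integrable (MeasureTheory.llr P Q) P
  then ((∫ x, MeasureTheory.llr P Q x ∂P : ℝ) : EReal)
  else ⊤


lemma measurable_dens {α : Type*} [MeasureSpace α] (P : Measure α) : Measurable (dens P) :=
  (Measure.measurable_rnDeriv _ _).ennreal_toReal

lemma dens_nonneg {α : Type*} [MeasureSpace α] (P : Measure α) (u : α) : 0 ≤ dens P u :=
  ENNReal.toReal_nonneg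

lemma integral_dens_mul {α : Type*} [MeasureSpace α] [SigmaFinite (volume : Measure α)]
    {P : Measure α} [SigmaFinite P] (hP : P ≪ volume) (g : α → ℝ) :
    ∫ u, dens P u * g u = ∫ u, g u ∂P :=
  integral_toReal_rnDeriv_mul hP

lemma integrable_dens_mul_iff {α : Type*} [MeasureSpace α] [SigmaFinite (volume : Measure α)]
    {P : Measure α} [SigmaFinite P] (hP : P ≪ volume) {g : α → ℝ} :
    Integrable (fun u => dens P u * g u) ↔ Integrable g P :=
  integrable_toReal_rnDeriv_mul_iff hP

lemma integrable_dens {α : Type*} [MeasureSpace α] (P : Measure α) [IsFiniteMeasure P] :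
    Integrable (dens P) :=
  Measure.integrable_toReal_rnDeriv

lemma integral_dens {α : Type*} [MeasureSpace α] [SigmaFinite (volume : Measure α)]
    {P : Measure α} [IsProbabilityMeasure P] (hP : P ≪ volume) : ∫ u, dens P u = 1 := by
  simpa using integral_dens_mul hP (fun _ => (1 : ℝ))

lemma dens_pos_ae {α : Type*} [MeasureSpace α] [SigmaFinite (volume : Measure α)]
    {P : Measure α} [SigmaFinite P] (hP : P ≪ volume) : ∀ᵐ u ∂P, 0 < dens P u := by
  filter_upwards [Measure.rnDeriv_pos hP, hP.ae_le (Measure.rnDeriv_lt_top P volume)] with u h1 h2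
  exact ENNReal.toReal_pos h1.ne' h2.ne

lemma ofReal_dens_ae {α : Type*} [MeasureSpace α] {P : Measure α} [SigmaFinite P] :
    ∀ᵐ u, ENNReal.ofReal (dens P u) = P.rnDeriv volume u := by
  filter_upwards [Measure.rnDeriv_lt_top P volume] with u hu
  exact ENNReal.ofReal_toReal hu.ne

lemma withDensity_dens {α : Type*} [MeasureSpace α] [SigmaFinite (volume : Measure α)]
    {P : Measure α} [SigmaFinite P] (hP : P ≪ volume) :
    volume.withDensity (fun u => ENNReal.ofReal (dens P u)) = P := by
  rw [withDensity_congr_ae ofReal_dens_ae, Measure.withDensity_rnDeriv_eq _ _ hP]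

lemma FiniteEnt.integrable_log_dens {α : Type*} [MeasureSpace α]
    [SigmaFinite (volume : Measure α)] {P : Measure α} [SigmaFinite P] (hP : P ≪ volume)
    (h : FiniteEnt P) : Integrable (fun u => Real.log (dens P u)) P :=
  (integrable_dens_mul_iff hP).1 h

lemma integral_log_dens {α : Type*} [MeasureSpace α] [SigmaFinite (volume : Measure α)]
    {P : Measure α} [SigmaFinite P] (hP : P ≪ volume) :
    ∫ u, Real.log (dens P u) ∂P = - diffEnt P := by
  rw [diffEnt, integral_dens_mul hP, neg_neg]

lemma measurableSet_cube (d : ℕ) : MeasurableSet (Cube d) :=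
  MeasurableSet.univ_pi fun _ => measurableSet_Icc

lemma volume_cube (d : ℕ) : volume (Cube d) = 1 := by
  rw [Cube, volume_pi_pi]
  simp

lemma ae_mem_cube {d : ℕ} {P : Measure (Fin d → ℝ)} [IsProbabilityMeasure P]
    (h : P (Cube d) = 1) : ∀ᵐ u ∂P, u ∈ Cube d :=
  (prob_compl_eq_zero_iff (measurableSet_cube d)).2 h

lemma dens_eq_zero_of_notMem_cube {d : ℕ} {P : Measure (Fin d → ℝ)} [IsProbabilityMeasure P]
    (h : P (Cube d) = 1) : ∀ᵐ u, u ∉ Cube d → dens P u = 0 := by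
  have h0 : P (Cube d)ᶜ = 0 := (prob_compl_eq_zero_iff (measurableSet_cube d)).2 h
  have h1 : ∫⁻ u in (Cube d)ᶜ, P.rnDeriv volume u = 0 :=
    le_antisymm ((Measure.setLIntegral_rnDeriv_le _).trans h0.le) bot_le
  rw [lintegral_eq_zero_iff (Measure.measurable_rnDeriv _ _)] at h1
  have h2 := (ae_restrict_iff' (measurableSet_cube d).compl).1 h1
  filter_upwards [h2] with u hu hc
  simp [dens, hu hc]

/-- Properties of the measure with a given nonnegative density. -/
lemma dens_withDensity {α : Type*} [MeasureSpace α] [SigmaFinite (volume : Measure α)]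
    {f : α → ℝ} (hf : Measurable f) (h0 : ∀ u, 0 ≤ f u) :
    dens (volume.withDensity fun u => ENNReal.ofReal (f u)) =ᵐ[volume] f := by
  filter_upwards [Measure.rnDeriv_withDensity volume hf.ennreal_ofReal] with u hu
  rw [dens, hu, ENNReal.toReal_ofReal (h0 u)]

/-- `Q` maximizes differential entropy among the laws on the cube with the same `φ`-moments
as `P`. -/
structure IsMaxEnt {d k : ℕ} (φ : (Fin d → ℝ) → Fin k → ℝ) (P Q : Measure (Fin d → ℝ)) :
    Prop where
  prob : IsProbabilityMeasure Q
  ac : Q ≪ volume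
  mass : Q (Cube d) = 1
  moment : ∀ j, ∫ u, φ u j ∂Q = ∫ u, φ u j ∂P
  fin : FiniteEnt Q
  max : ∀ S : Measure (Fin d → ℝ), IsProbabilityMeasure S → S ≪ volume → S (Cube d) = 1 →
    (∀ j, ∫ u, φ u j ∂S = ∫ u, φ u j ∂P) → FiniteEnt S → diffEnt S ≤ diffEnt Q

section MaxEnt

variable {d k : ℕ} {φ : (Fin d → ℝ) → Fin k → ℝ} {P Q : Measure (Fin d → ℝ)}

lemma IsMaxEnt.density_le (hQ : IsMaxEnt φ P Q) {f : (Fin d → ℝ) → ℝ} (hf : Measurable f)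
    (h0 : ∀ u, 0 ≤ f u) (hfi : Integrable f) (h1 : ∫ u, f u = 1)
    (hc : ∀ᵐ u, u ∉ Cube d → f u = 0) (hm : ∀ j, ∫ u, f u * φ u j = ∫ u, φ u j ∂P)
    (hent : Integrable fun u => f u * Real.log (f u)) :
    - ∫ u, f u * Real.log (f u) ≤ diffEnt Q := by
  have hd := dens_withDensity hf h0
  have hprob : IsProbabilityMeasure (volume.withDensity fun u => ENNReal.ofReal (f u)) := by
    constructor
    rw [withDensity_apply _ MeasurableSet.univ, Measure.restrict_univ,
      ← ofReal_integral_eq_lintegral_ofReal hfi (ae_of_all _ h0), h1, ENNReal.ofReal_one]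
  have hd' : (fun u => f u * Real.log (f u)) =ᵐ[volume] fun u =>
      dens (volume.withDensity fun u => ENNReal.ofReal (f u)) u *
        Real.log (dens (volume.withDensity fun u => ENNReal.ofReal (f u)) u) := by
    filter_upwards [hd] with u hu
    rw [hu]
  have key := hQ.max (volume.withDensity fun u => ENNReal.ofReal (f u)) hprob
    (withDensity_absolutelyContinuous _ _) ?_ ?_ (hent.congr hd')
  · rwa [diffEnt, ← integral_congr_ae hd'] at key
  · rw [← prob_compl_eq_zero_iff (measurableSet_cube d),
      withDensity_apply _ (measurableSet_cube d).compl,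
      setLIntegral_congr_fun_ae (g := fun _ => 0) (measurableSet_cube d).compl, lintegral_zero]
    filter_upwards [hc] with u hu hu'
    simp [hu hu']
  · intro j
    rw [← hm j, integral_withDensity_eq_integral_toReal_smul hf.ennreal_ofReal
      (ae_of_all _ fun _ => ENNReal.ofReal_lt_top)]
    simp [ENNReal.toReal_ofReal (h0 _)]

lemma integrable_moment [IsProbabilityMeasure P] (hP : P (Cube d) = 1) (hφc : Continuous φ)
    (hφb : ∃ C, ∀ u ∈ Cube d, ∀ j, |φ u j| ≤ C) (j : Fin k) :
    Integrable (fun u => φ u j) P := by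
  obtain ⟨C, hC⟩ := hφb
  refine Integrable.of_bound (Continuous.aestronglyMeasurable (by fun_prop)) C ?_
  filter_upwards [ae_mem_cube hP] with u hu using hC u hu j

lemma IsMaxEnt.absolutelyContinuous (hQ : IsMaxEnt φ P Q) [IsProbabilityMeasure P]
    (hPac : P ≪ volume) (hPm : P (Cube d) = 1) (hPf : FiniteEnt P) (hφc : Continuous φ)
    (hφb : ∃ C, ∀ u ∈ Cube d, ∀ j, |φ u j| ≤ C) : P ≪ Q := by
  have := hQ.prob
  set p := dens P with hp
  set q := dens Q with hq
  have hpm : Measurable p := measurable_dens P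
  have hqm : Measurable q := measurable_dens Q
  have hp0 : ∀ u, 0 ≤ p u := dens_nonneg P
  have hq0 : ∀ u, 0 ≤ q u := dens_nonneg Q
  have hpi : Integrable p := integrable_dens P
  have hqi : Integrable q := integrable_dens Q
  have hpc := dens_eq_zero_of_notMem_cube hPm
  have hqc := dens_eq_zero_of_notMem_cube hQ.mass
  have hZ : MeasurableSet {u | q u = 0} := hqm (measurableSet_singleton 0)
  have hpe : Integrable fun u => (p u).negMulLog :=
    hPf.neg.congr (ae_of_all _ fun u => by simp [negMulLog, hp])
  have hqe : Integrable fun u => (q u).negMulLog :=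
    hQ.fin.neg.congr (ae_of_all _ fun u => by simp [negMulLog, hq])
  have hhP : diffEnt P = ∫ u, (p u).negMulLog := by
    rw [diffEnt, ← integral_neg]; simp [negMulLog, hp]
  have hhQ : diffEnt Q = ∫ u, (q u).negMulLog := by
    rw [diffEnt, ← integral_neg]; simp [negMulLog, hq]
  have hineq : ∀ t ∈ Ioo (0 : ℝ) 1,
      diffEnt P - Real.log t * ∫ u, {u | q u = 0}.indicator p u ≤ diffEnt Q := by
    rintro t ⟨ht0, ht1⟩
    have hlow : ∀ u, (1 - t) * (q u).negMulLog + t * (p u).negMulLog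
        - (t * Real.log t) * {u | q u = 0}.indicator p u
        ≤ ((1 - t) * q u + t * p u).negMulLog := by
      intro u
      by_cases hu : q u = 0
      · rw [Set.indicator_of_mem (by exact hu), hu]
        simp only [mul_zero, zero_add, negMulLog_zero, negMulLog_mul]
        apply le_of_eq
        simp only [negMulLog]; ring
      · rw [Set.indicator_of_notMem (by exact hu)]
        have := concaveOn_negMulLog.2 (hq0 u) (hp0 u) (by linarith : 0 ≤ 1 - t) ht0.le (by ring)
        simpa using this
    have hlowi : Integrable fun u => (1 - t) * (q u).negMulLog + t * (p u).negMulLog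
        - (t * Real.log t) * {u | q u = 0}.indicator p u :=
      ((hqe.const_mul _).add (hpe.const_mul _)).sub ((hpi.indicator hZ).const_mul _)
    have hf0 : ∀ u, 0 ≤ (1 - t) * q u + t * p u := fun u =>
      add_nonneg (mul_nonneg (by linarith) (hq0 u)) (mul_nonneg ht0.le (hp0 u))
    have hfm : Measurable fun u => (1 - t) * q u + t * p u := by fun_prop
    have hfc : ∀ᵐ u, u ∉ Cube d → (1 - t) * q u + t * p u = 0 := by
      filter_upwards [hpc, hqc] with u h1 h2 h
      rw [hp, hq, h1 h, h2 h]; ring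
    have hup : Integrable ((Cube d).indicator fun _ => (1 : ℝ)) :=
      (integrable_indicator_iff (measurableSet_cube d)).2
        (integrableOn_const (by simp [volume_cube]))
    have hfe : Integrable fun u => ((1 - t) * q u + t * p u).negMulLog := by
      refine integrable_of_le_of_le (continuous_negMulLog.measurable.comp hfm).aestronglyMeasurable
        (ae_of_all _ hlow) ?_ hlowi hup
      filter_upwards [hfc] with u hu
      by_cases h : u ∈ Cube d
      · rw [Set.indicator_of_mem h]
        linarith [negMulLog_le_one_sub_self (hf0 u), hf0 u]
      · rw [hu h]; simp [h]
    have hmax := hQ.density_le hfm hf0 ((hqi.const_mul _).add (hpi.const_mul _)) ?_ hfc ?_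
      (hfe.neg.congr (ae_of_all _ fun u => by simp only [negMulLog, Pi.neg_apply]; ring))
    · have h1 := integral_mono hlowi hfe hlow
      rw [integral_sub (by exact (hqe.const_mul _).add (hpe.const_mul _))
          ((hpi.indicator hZ).const_mul _),
        integral_add (hqe.const_mul _) (hpe.const_mul _), integral_const_mul, integral_const_mul,
        integral_const_mul, ← hhP, ← hhQ] at h1
      rw [← integral_neg] at hmax
      simp only [← neg_mul] at hmax
      have h2 := h1.trans hmax
      refine le_of_mul_le_mul_left ?_ ht0
      linarith
    · rw [integral_add (hqi.const_mul _) (hpi.const_mul _), integral_const_mul,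
        integral_const_mul, integral_dens hQ.ac, integral_dens hPac]
      ring
    · intro j
      have hPj := (integrable_dens_mul_iff hPac).2 (integrable_moment hPm hφc hφb j)
      have hQj := (integrable_dens_mul_iff hQ.ac).2 (integrable_moment hQ.mass hφc hφb j)
      have : ∀ u, ((1 - t) * q u + t * p u) * φ u j
          = (1 - t) * (q u * φ u j) + t * (p u * φ u j) := fun u => by ring
      simp_rw [this]
      rw [integral_add (hQj.const_mul _) (hPj.const_mul _), integral_const_mul,
        integral_const_mul, integral_dens_mul hQ.ac, integral_dens_mul hPac, hQ.moment j]
      ring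
  have hI0 : 0 ≤ ∫ u, {u | q u = 0}.indicator p u :=
    integral_nonneg fun u => Set.indicator_nonneg (fun u _ => hp0 u) u
  have hI : ∫ u, {u | q u = 0}.indicator p u = 0 := by
    by_contra hne
    have hpos := lt_of_le_of_ne hI0 (Ne.symm hne)
    set c := ∫ u, {u | q u = 0}.indicator p u
    set s := -((|diffEnt Q - diffEnt P| + 1) / c) with hs
    have hs0 : s < 0 := by rw [hs]; have : 0 < (|diffEnt Q - diffEnt P| + 1) / c := by positivity
                           linarith
    have h1 := hineq (Real.exp s) ⟨Real.exp_pos s, by simpa using hs0⟩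
    rw [Real.log_exp, hs, neg_mul, div_mul_cancel₀ _ hpos.ne'] at h1
    linarith [le_abs_self (diffEnt Q - diffEnt P)]
  have hPZ : P {u | q u = 0} = 0 := by
    rw [integral_eq_zero_iff_of_nonneg (fun u => Set.indicator_nonneg (fun u _ => hp0 u) u)
      (hpi.indicator hZ)] at hI
    have h1 : ∀ᵐ u ∂P, u ∉ {u | q u = 0} := by
      filter_upwards [hPac.ae_le hI, dens_pos_ae hPac] with u h1 h2 h3
      rw [Set.indicator_of_mem (by exact h3)] at h1
      exact h2.ne' h1
    exact measure_eq_zero_iff_ae_notMem.2 h1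
  refine Measure.AbsolutelyContinuous.mk fun s hs hQs => ?_
  have h1 : ∫⁻ u in s, Q.rnDeriv volume u = 0 :=
    le_antisymm ((Measure.setLIntegral_rnDeriv_le _).trans hQs.le) bot_le
  rw [lintegral_eq_zero_iff (Measure.measurable_rnDeriv _ _)] at h1
  have h2 := (ae_restrict_iff' hs).1 h1
  refine measure_eq_zero_iff_ae_notMem.2 ?_
  filter_upwards [hPac.ae_le h2, measure_eq_zero_iff_ae_notMem.1 hPZ] with u h3 h4 h5
  exact h4 (by simp [hq, dens, h3 h5])

/-- Integration against an integrable weight, as a linear form on simple functions. -/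
def weightedIntegral {α : Type*} [MeasurableSpace α] (Q : Measure α) (w : α → ℝ)
    (hw : Integrable w Q) : SimpleFunc α ℝ →ₗ[ℝ] ℝ where
  toFun g := ∫ u, g u * w u ∂Q
  map_add' g h := by
    have hi : ∀ g : SimpleFunc α ℝ, Integrable (fun u => g u * w u) Q := fun g => by
      obtain ⟨C, hC⟩ := g.exists_forall_norm_le
      exact hw.bdd_mul g.aestronglyMeasurable (ae_of_all _ hC)
    simp only [SimpleFunc.coe_add, Pi.add_apply, add_mul]
    exact integral_add (hi g) (hi h)
  map_smul' c g := by
    simp only [SimpleFunc.coe_smul, Pi.smul_apply, smul_eq_mul, mul_assoc, RingHom.id_apply]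
    exact integral_const_mul _ _

lemma weightedIntegral_apply {α : Type*} [MeasurableSpace α] (Q : Measure α) (w : α → ℝ)
    (hw : Integrable w Q) (g : SimpleFunc α ℝ) :
    weightedIntegral Q w hw g = ∫ u, g u * w u ∂Q := rfl

lemma eq_zero_of_forall_mul_le_sq {a C : ℝ} (hC : 0 < C)
    (h : ∀ t : ℝ, |t| * C ≤ 1 → t * a ≤ t ^ 2 * C ^ 2) : a = 0 := by
  by_contra ha
  have hapos : 0 < |a| := abs_pos.2 ha
  set e : ℝ := 1 / (C * |a| + 2 * C ^ 2 + 1) with he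
  have hD : 0 < C * |a| + 2 * C ^ 2 + 1 := by positivity
  have he0 : 0 < e := by positivity
  have heD : e * (C * |a| + 2 * C ^ 2 + 1) = 1 := by rw [he]; field_simp
  have h1 := h (e * a) (by
    rw [abs_mul, abs_of_pos he0]
    nlinarith [mul_pos he0 (pow_pos hC 2)])
  have h2 : e * C ^ 2 < 1 := by nlinarith [mul_pos he0 (mul_pos hC hapos), mul_pos he0 (pow_pos hC 2)]
  have h3 : 0 < e * a ^ 2 := by positivity
  nlinarith

lemma IsMaxEnt.integral_mul_log_dens_eq_zero (hQ : IsMaxEnt φ P Q) (hφc : Continuous φ)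
    (hφb : ∃ C, ∀ u ∈ Cube d, ∀ j, |φ u j| ≤ C) {g : (Fin d → ℝ) → ℝ} (hg : Measurable g)
    {C : ℝ} (hC : ∀ u, |g u| ≤ C) (hg0 : ∫ u, g u ∂Q = 0)
    (hgφ : ∀ j, ∫ u, g u * φ u j ∂Q = 0) : ∫ u, g u * Real.log (dens Q u) ∂Q = 0 := by
  have := hQ.prob
  have hac := hQ.ac
  wlog hCpos : 0 < C generalizing C
  · exact this (C := |C| + 1) (fun u => (hC u).trans (by linarith [le_abs_self C])) (by positivity)
  rw [← neg_eq_zero]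
  refine eq_zero_of_forall_mul_le_sq hCpos fun t ht => ?_
  set q := dens Q with hq
  have hqm : Measurable q := measurable_dens Q
  have hq0 : ∀ u, 0 ≤ q u := dens_nonneg Q
  have htg : ∀ u, |t * g u| ≤ 1 := fun u => by
    rw [abs_mul]
    exact (mul_le_mul_of_nonneg_left (hC u) (abs_nonneg t)).trans ht
  have hs0 : ∀ u, 0 ≤ 1 + t * g u := fun u => by linarith [neg_le_of_abs_le (htg u)]
  have hlog : Integrable (fun u => Real.log (q u)) Q := hQ.fin.integrable_log_dens hac
  have hgi : Integrable g Q := Integrable.of_bound hg.aestronglyMeasurable C (ae_of_all _ hC)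
  have hglog : Integrable (fun u => g u * Real.log (q u)) Q :=
    hlog.bdd_mul hg.aestronglyMeasurable (ae_of_all _ hC)
  have hsi : Integrable (fun u => (1 + t * g u) * Real.log (1 + t * g u)) Q := by
    have hnm : Measurable fun u => (1 + t * g u) * Real.log (1 + t * g u) := by fun_prop
    have hcont : ContinuousOn (fun s : ℝ => s * Real.log s) (Icc 0 2) :=
      Real.continuous_mul_log.continuousOn
    obtain ⟨B, hB⟩ := isCompact_Icc.exists_bound_of_continuousOn hcont
    refine Integrable.of_bound hnm.aestronglyMeasurable B (ae_of_all _ fun u => ?_)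
    exact hB _ ⟨hs0 u, by linarith [le_of_abs_le (htg u)]⟩
  have hfe : ∀ u, (q u * (1 + t * g u)) * Real.log (q u * (1 + t * g u))
      = q u * (Real.log (q u) + t * (g u * Real.log (q u))
        + (1 + t * g u) * Real.log (1 + t * g u)) := fun u => by
    have := negMulLog_mul (q u) (1 + t * g u)
    simp only [negMulLog] at this
    linarith
  have hsum := (hlog.add (hglog.const_mul t)).add hsi
  have hmax := hQ.density_le (f := fun u => q u * (1 + t * g u)) (by fun_prop)
    (fun u => mul_nonneg (hq0 u) (hs0 u)) ?_ ?_ ?_ ?_ ?_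
  · simp_rw [hfe] at hmax
    rw [integral_dens_mul hac, integral_add (by exact hlog.add (hglog.const_mul t)) hsi,
      integral_add hlog (hglog.const_mul t), integral_const_mul, integral_log_dens hac] at hmax
    have hle : ∫ u, (1 + t * g u) * Real.log (1 + t * g u) ∂Q ≤
        ∫ u, (t * g u + t ^ 2 * C ^ 2) ∂Q := by
      refine integral_mono hsi ((hgi.const_mul t).add (integrable_const _)) fun u => ?_
      have h1 : (1 + t * g u) * Real.log (1 + t * g u) ≤ (1 + t * g u) * (t * g u) := by
        rcases (hs0 u).eq_or_lt with h | h
        · rw [← h]; simp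
        · exact mul_le_mul_of_nonneg_left (by linarith [Real.log_le_sub_one_of_pos h]) h.le
      have h2 : g u ^ 2 ≤ C ^ 2 := sq_le_sq.2 ((hC u).trans (le_abs_self C))
      have h3 := mul_le_mul_of_nonneg_left h2 (sq_nonneg t)
      have : (1 + t * g u) * (t * g u) = t * g u + t ^ 2 * g u ^ 2 := by ring
      simp only
      linarith
    rw [integral_add (hgi.const_mul t) (integrable_const _), integral_const_mul, hg0] at hle
    simp at hle
    linarith
  · exact (integrable_dens_mul_iff hac).2 ((integrable_const 1).add (hgi.const_mul t))
  · rw [integral_dens_mul hac, integral_add (integrable_const 1) (hgi.const_mul t),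
      integral_const_mul, hg0]
    simp
  · filter_upwards [dens_eq_zero_of_notMem_cube hQ.mass] with u hu h
    rw [hq, hu h, zero_mul]
  · intro j
    have hj := integrable_moment hQ.mass hφc hφb j
    have hgj : Integrable (fun u => g u * φ u j) Q :=
      hj.bdd_mul hg.aestronglyMeasurable (ae_of_all _ hC)
    have : ∀ u, q u * (1 + t * g u) * φ u j = q u * (φ u j + t * (g u * φ u j)) :=
      fun u => by ring
    simp_rw [this]
    rw [integral_dens_mul hac, integral_add hj (hgj.const_mul t), integral_const_mul, hgφ j,
      hQ.moment j]
    ring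
  · simp_rw [hfe]
    exact (integrable_dens_mul_iff hac).2 hsum

/-- A maximum-entropy law has an exponential-family density on its support. -/
lemma IsMaxEnt.exists_log_dens_eq (hQ : IsMaxEnt φ P Q) (hφc : Continuous φ)
    (hφb : ∃ C, ∀ u ∈ Cube d, ∀ j, |φ u j| ≤ C) (hφ1 : ∃ j, ∀ u, φ u j = 1) :
    ∃ θ : Fin k → ℝ, ∀ᵐ u ∂Q, Real.log (dens Q u) = ∑ j, θ j * φ u j := by
  have := hQ.prob
  have hlog := hQ.fin.integrable_log_dens hQ.ac
  have hφi := fun j => integrable_moment hQ.mass hφc hφb j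
  have hker : ⨅ j, LinearMap.ker (weightedIntegral Q _ (hφi j)) ≤
      LinearMap.ker (weightedIntegral Q _ hlog) := by
    intro g hg
    simp only [Submodule.mem_iInf, LinearMap.mem_ker, weightedIntegral_apply] at hg ⊢
    obtain ⟨C, hC⟩ := g.exists_forall_norm_le
    obtain ⟨j, hj⟩ := hφ1
    refine hQ.integral_mul_log_dens_eq_zero hφc hφb g.measurable hC ?_ hg
    simpa [hj] using hg j
  obtain ⟨θ, hθ⟩ := (Submodule.mem_span_range_iff_exists_fun ℝ).1 (mem_span_of_iInf_ker_le_ker hker)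
  refine ⟨θ, ?_⟩
  have hsi : Integrable (fun u => ∑ j, θ j * φ u j) Q :=
    integrable_finsetSum _ fun j _ => (hφi j).const_mul (θ j)
  have hz := (hlog.sub hsi).ae_eq_zero_of_forall_setIntegral_eq_zero fun s hs _ => ?_
  · filter_upwards [hz] with u hu
    simpa [sub_eq_zero] using hu
  · have h := LinearMap.congr_fun hθ (SimpleFunc.piecewise s hs (SimpleFunc.const _ 1)
      (SimpleFunc.const _ 0))
    have hw : ∀ w : (Fin d → ℝ) → ℝ, ∀ hw : Integrable w Q, weightedIntegral Q w hw
        (SimpleFunc.piecewise s hs (SimpleFunc.const _ 1) (SimpleFunc.const _ 0))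
        = ∫ u in s, w u ∂Q := fun w hw => by
      rw [weightedIntegral_apply, ← integral_indicator hs]
      congr with u
      by_cases hu : u ∈ s <;> simp [hu]
    simp only [LinearMap.sum_apply, LinearMap.smul_apply, hw, smul_eq_mul] at h
    simp only [Pi.sub_apply]
    rw [integral_sub hlog.integrableOn hsi.integrableOn,
      integral_finsetSum _ fun j _ => ((hφi j).const_mul (θ j)).integrableOn, ← h]
    simp [integral_const_mul]

/-- The Kullback-Leibler divergence to a maximum-entropy law is a difference of entropies. -/
lemma IsMaxEnt.klDiv_eq (hQ : IsMaxEnt φ P Q) [IsProbabilityMeasure P]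
    (hPac : P ≪ volume) (hPm : P (Cube d) = 1) (hPf : FiniteEnt P) (hφc : Continuous φ)
    (hφb : ∃ C, ∀ u ∈ Cube d, ∀ j, |φ u j| ≤ C) (hφ1 : ∃ j, ∀ u, φ u j = 1) :
    klDiv P Q = ((diffEnt Q - diffEnt P : ℝ) : EReal) := by
  have := hQ.prob
  have hPQ := hQ.absolutelyContinuous hPac hPm hPf hφc hφb
  obtain ⟨θ, hθ⟩ := hQ.exists_log_dens_eq hφc hφb hφ1
  have hlogP := hPf.integrable_log_dens hPac
  have hiP : Integrable (fun u => ∑ j, θ j * φ u j) P :=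
    integrable_finsetSum _ fun j _ => (integrable_moment hPm hφc hφb j).const_mul (θ j)
  have hllr : llr P Q =ᵐ[P] fun u => Real.log (dens P u) - ∑ j, θ j * φ u j := by
    filter_upwards [hPac.ae_le (Measure.rnDeriv_mul_rnDeriv (κ := volume) hPQ), hPQ.ae_le hθ,
      dens_pos_ae hPac] with u h1 h2 h3
    have h4 : (P.rnDeriv Q u).toReal * dens Q u = dens P u := by
      rw [dens, dens, ← h1, Pi.mul_apply, ENNReal.toReal_mul]
    rw [← h4] at h3
    rw [← h2, ← h4, Real.log_mul (left_ne_zero_of_mul h3.ne') (right_ne_zero_of_mul h3.ne'), llr]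
    ring
  have hint : Integrable (llr P Q) P := (hlogP.sub hiP).congr hllr.symm
  rw [klDiv, if_pos ⟨hPQ, hint⟩, integral_congr_ae hllr, integral_sub hlogP hiP,
    integral_log_dens hPac]
  have hQi : ∫ u, ∑ j, θ j * φ u j ∂P = - diffEnt Q := by
    rw [← integral_log_dens hQ.ac, integral_congr_ae hθ,
      integral_finsetSum _ fun j _ => (integrable_moment hPm hφc hφb j).const_mul (θ j),
      integral_finsetSum _ fun j _ => (integrable_moment hQ.mass hφc hφb j).const_mul (θ j)]
    simp [integral_const_mul, hQ.moment]
  rw [hQi]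
  congr 1
  ring

end MaxEnt

lemma pi_absolutelyContinuous : ∀ {d : ℕ} {μ ν : Fin d → Measure ℝ} [∀ i, SigmaFinite (μ i)]
    [∀ i, SigmaFinite (ν i)], (∀ i, μ i ≪ ν i) → Measure.pi μ ≪ Measure.pi ν
  | 0, μ, ν, _, _, _ => by
    rw [Measure.pi_of_empty, Measure.pi_of_empty]
  | d + 1, μ, ν, _, _, h => by
    rw [← (measurePreserving_piFinSuccAbove μ 0).symm.map_eq,
      ← (measurePreserving_piFinSuccAbove ν 0).symm.map_eq]
    exact ((h 0).prod (pi_absolutelyContinuous fun j => h _)).map (MeasurableEquiv.measurable _)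

section Cdf

variable {ρ : Measure ℝ} [IsProbabilityMeasure ρ] {G : ℝ → ℝ}

lemma cdf_eq_of_apply (hG : ∀ t, G t = (ρ (Iic t)).toReal) : G = ProbabilityTheory.cdf ρ := by
  ext t
  rw [hG t, ProbabilityTheory.cdf_eq_real, measureReal_def]

lemma cdf_mem_Icc (hG : ∀ t, G t = (ρ (Iic t)).toReal) (t : ℝ) : G t ∈ Icc (0 : ℝ) 1 := by
  rw [cdf_eq_of_apply hG]
  exact ⟨ProbabilityTheory.cdf_nonneg _ _, ProbabilityTheory.cdf_le_one _ _⟩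

lemma monotone_of_cdf (hG : ∀ t, G t = (ρ (Iic t)).toReal) : Monotone G := by
  rw [cdf_eq_of_apply hG]
  exact ProbabilityTheory.monotone_cdf ρ

lemma measure_flat_cdf (hG : ∀ t, G t = (ρ (Iic t)).toReal) (a : ℝ) :
    ρ {t | a < t ∧ G t ≤ G a} = 0 := by
  have hIoc : ∀ y, a < y → G y ≤ G a → ρ (Ioc a y) = 0 := fun y hay hy => by
    rw [← Iic_sdiff_Iic, measure_sdiff (Iic_subset_Iic.2 hay.le) measurableSet_Iic.nullMeasurableSet
      (measure_ne_top _ _), tsub_eq_zero_iff_le]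
    rw [hG, hG] at hy
    exact (ENNReal.toReal_le_toReal (measure_ne_top _ _) (measure_ne_top _ _)).1 hy
  refine measure_null_of_locally_null _ fun x hx => ?_
  by_cases h : ∃ y, x < y ∧ G y ≤ G a
  · obtain ⟨y, hxy, hy⟩ := h
    exact ⟨Ioc a y, mem_nhdsWithin_of_mem_nhds (Ioc_mem_nhds hx.1 hxy),
      hIoc y (hx.1.trans hxy) hy⟩
  · push Not at h
    refine ⟨Ioc a x, mem_of_superset self_mem_nhdsWithin fun y hy => ⟨hy.1, ?_⟩, hIoc x hx.1 hx.2⟩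
    by_contra hxy
    exact absurd hy.2 (not_le.2 (h y (not_le.1 hxy)))

lemma measure_cdf_le (hG : ∀ t, G t = (ρ (Iic t)).toReal) (a : ℝ) :
    ρ {t | G t ≤ G a} = ρ (Iic a) := by
  have : {t | G t ≤ G a} = Iic a ∪ {t | a < t ∧ G t ≤ G a} := by
    ext t
    simp only [mem_ofPred_eq, mem_union, mem_Iic]
    rcases le_or_gt t a with h | h
    · simp [h, monotone_of_cdf hG h]
    · simp [h, h.not_ge]
  rw [this]
  exact le_antisymm ((measure_union_le _ _).trans (by rw [measure_flat_cdf hG, add_zero]))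
    (measure_mono subset_union_left)

/-- Probability integral transform. -/
lemma map_cdf_eq_unif01 (hG : ∀ t, G t = (ρ (Iic t)).toReal) (hGc : Continuous G) :
    ρ.map G = unif01 := by
  have : IsFiniteMeasure (ρ.map G) := Measure.isFiniteMeasure_map _ _
  refine Measure.ext_of_Iic _ _ fun s => ?_
  rw [Measure.map_apply hGc.measurable measurableSet_Iic, unif01,
    Measure.restrict_apply measurableSet_Iic]
  have hI := cdf_mem_Icc hG
  rcases lt_or_ge s 0 with hs | hs
  · have h1 : G ⁻¹' Iic s = ∅ := by
      ext t; simpa using hs.trans_le (hI t).1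
    have h2 : Iic s ∩ Icc (0 : ℝ) 1 = ∅ := by
      ext t; simp only [mem_inter_iff, mem_Iic, mem_Icc, mem_empty_iff_false, iff_false]
      intro h; linarith [h.1, h.2.1]
    rw [h1, h2]; simp
  rcases le_or_gt 1 s with hs1 | hs1
  · have h1 : G ⁻¹' Iic s = univ := by
      ext t; simpa using (hI t).2.trans hs1
    have h2 : Iic s ∩ Icc (0 : ℝ) 1 = Icc 0 1 :=
      inter_eq_right.2 fun t ht => ht.2.trans hs1
    rw [h1, h2]; simp
  have h2 : Iic s ∩ Icc (0 : ℝ) 1 = Icc 0 s := by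
    ext t; simp only [mem_inter_iff, mem_Iic, mem_Icc]
    constructor
    · rintro ⟨h1, h2, -⟩; exact ⟨h2, h1⟩
    · rintro ⟨h1, h2⟩; exact ⟨h2, h1, h2.trans hs1.le⟩
  rw [h2, Real.volume_Icc, sub_zero]
  have htop : Tendsto G atTop (nhds 1) := by
    rw [cdf_eq_of_apply hG]; exact ProbabilityTheory.tendsto_cdf_atTop ρ
  have hbot : Tendsto G atBot (nhds 0) := by
    rw [cdf_eq_of_apply hG]; exact ProbabilityTheory.tendsto_cdf_atBot ρ
  by_cases h : ∃ a, G a ≤ s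
  · obtain ⟨a, ha⟩ := mem_range_of_exists_le_of_exists_ge hGc h
      ((htop.eventually (lt_mem_nhds hs1)).exists.imp fun _ h => h.le)
    have := measure_cdf_le hG a
    rw [← ENNReal.ofReal_toReal (measure_ne_top ρ (Iic a)), ← hG a, ha] at this
    exact this
  · push Not at h
    have hs0 : s = 0 := by
      refine le_antisymm (not_lt.1 fun hpos => ?_) hs
      obtain ⟨a, ha⟩ := (hbot.eventually (gt_mem_nhds hpos)).exists
      exact absurd (h a) (not_lt.2 ha.le)
    have h1 : G ⁻¹' Iic s = ∅ := by
      ext t; simpa using h t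
    rw [h1, hs0]; simp

end Cdf

/-- The joint law of the marginal probability integral transforms has a density when the
original law does. -/
lemma map_cdf_absolutelyContinuous {d : ℕ} {ν : Measure (Fin d → ℝ)} [IsProbabilityMeasure ν]
    (hν : ν ≪ volume) {F : Fin d → ℝ → ℝ}
    (hF : ∀ i t, F i t = (ν.map (fun v => v i) (Iic t)).toReal) (hFc : ∀ i, Continuous (F i)) :
    ν.map (fun v i => F i (v i)) ≪ volume := by
  have hprob : ∀ i, IsProbabilityMeasure (ν.map fun v : Fin d → ℝ => v i) := fun i =>
    Measure.isProbabilityMeasure_map (measurable_pi_apply i).aemeasurable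
  set ρ : Fin d → Measure ℝ := fun i => ν.map (fun v => v i) with hρ
  have hρac : ∀ i, ρ i ≪ volume := fun i =>
    (hν.map (measurable_pi_apply i)).trans (Measure.quasiMeasurePreserving_eval _ i).absolutelyContinuous
  set S : Fin d → Set ℝ := fun i => {t | 0 < dens (ρ i) t} with hS
  have hSm : ∀ i, MeasurableSet (S i) := fun i =>
    measurableSet_lt measurable_const (measurable_dens _)
  have hSρ : ∀ i, volume.restrict (S i) ≪ ρ i := fun i => by
    refine Measure.AbsolutelyContinuous.mk fun s hs h0 => ?_
    have h1 : ∫⁻ u in s, (ρ i).rnDeriv volume u = 0 :=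
      le_antisymm ((Measure.setLIntegral_rnDeriv_le _).trans h0.le) bot_le
    rw [lintegral_eq_zero_iff (Measure.measurable_rnDeriv _ _)] at h1
    rw [Measure.restrict_apply hs]
    refine measure_eq_zero_iff_ae_notMem.2 ?_
    filter_upwards [(ae_restrict_iff' hs).1 h1] with t ht hts
    have : 0 < dens (ρ i) t := hts.2
    simp [dens, ht hts.1] at this
  have hνS : ν ≪ volume.restrict (univ.pi S) := by
    refine Measure.AbsolutelyContinuous.mk fun s hs h0 => ?_
    rw [Measure.restrict_apply hs] at h0
    have h1 : ∀ᵐ v ∂ν, ∀ i, v i ∈ S i := ae_all_iff.2 fun i =>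
      ae_of_ae_map (measurable_pi_apply i).aemeasurable (dens_pos_ae (hρac i))
    refine measure_eq_zero_iff_ae_notMem.2 ?_
    filter_upwards [h1, measure_eq_zero_iff_ae_notMem.1 (hν h0)] with v h2 h3 h4
    exact h3 ⟨h4, fun i _ => h2 i⟩
  have hνpi : ν ≪ Measure.pi ρ := by
    rw [volume_pi, Measure.restrict_pi_pi] at hνS
    exact hνS.trans (pi_absolutelyContinuous hSρ)
  have hmap : ∀ i, (ρ i).map (F i) = unif01 := fun i => map_cdf_eq_unif01 (hF i) (hFc i)
  have hfin : IsFiniteMeasure unif01 := by unfold unif01; infer_instance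
  have hT : Measurable fun (v : Fin d → ℝ) i => F i (v i) :=
    measurable_pi_lambda _ fun i => (hFc i).measurable.comp (measurable_pi_apply i)
  have hsf : ∀ i, SigmaFinite ((ρ i).map (F i)) := fun i => by rw [hmap i]; infer_instance
  refine (hνpi.map hT).trans ?_
  rw [Measure.pi_map_pi fun i => (hFc i).measurable.aemeasurable, volume_pi]
  refine pi_absolutelyContinuous fun i => ?_
  rw [hmap i]
  exact Measure.absolutelyContinuous_of_le Measure.restrict_le_self

lemma measurable_append {p q : ℕ} :
    Measurable fun z : (Fin p → ℝ) × (Fin q → ℝ) => Fin.append z.1 z.2 := by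
  refine measurable_pi_iff.2 fun i => ?_
  refine Fin.addCases (fun i => ?_) (fun i => ?_) i
  · simp only [Fin.append_left]; fun_prop
  · simp only [Fin.append_right]; fun_prop

lemma measurePreserving_append (p q : ℕ) :
    MeasurePreserving (fun z : (Fin p → ℝ) × (Fin q → ℝ) => Fin.append z.1 z.2) := by
  refine ⟨measurable_append, ?_⟩
  rw [volume_pi]
  refine (Measure.pi_eq fun s hs => ?_).symm
  have : (fun z : (Fin p → ℝ) × (Fin q → ℝ) => Fin.append z.1 z.2) ⁻¹' univ.pi s =
      (univ.pi fun i => s (Fin.castAdd q i)) ×ˢ (univ.pi fun i => s (Fin.natAdd p i)) := by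
    ext z
    simp only [mem_preimage, mem_univ_pi, mem_prod]
    constructor
    · intro h
      exact ⟨fun i => by simpa using h (Fin.castAdd q i), fun i => by simpa using h (Fin.natAdd p i)⟩
    · rintro ⟨h1, h2⟩ i
      refine Fin.addCases (fun i => ?_) (fun i => ?_) i
      · simpa using h1 i
      · simpa using h2 i
  rw [Measure.map_apply measurable_append (MeasurableSet.univ_pi hs), this,
    Measure.volume_eq_prod, Measure.prod_prod, volume_pi_pi, volume_pi_pi, Fin.prod_univ_add]

/-- Kullback-Leibler divergence is preserved by a map that generates the σ-algebra up to null
sets. -/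
lemma klDiv_map_of_generating {α β : Type*} [mα : MeasurableSpace α] [mβ : MeasurableSpace β]
    {M N : Measure α} [IsFiniteMeasure M] [IsFiniteMeasure N] {T : α → β} (hT : Measurable T)
    (hgen : mα ≤ eventuallyMeasurableSpace (mβ.comap T) (ae (M + N)))
    (hac : M.map T ≪ N.map T) : klDiv M N = klDiv (M.map T) (N.map T) := by
  set r := (M.map T).rnDeriv (N.map T) with hr
  have hrm : Measurable r := Measure.measurable_rnDeriv _ _
  have hMN : M = N.withDensity (r ∘ T) := by
    ext s hs
    obtain ⟨t, ⟨B, hB, rfl⟩, hst⟩ := hgen s hs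
    have hst' : s =ᵐ[M] T ⁻¹' B ∧ s =ᵐ[N] T ⁻¹' B :=
      ⟨hst.filter_mono (ae_mono (Measure.le_add_right le_rfl)),
        hst.filter_mono (ae_mono (Measure.le_add_left le_rfl))⟩
    rw [measure_congr hst'.1,
      measure_congr ((withDensity_absolutelyContinuous N (r ∘ T)).ae_le hst'.2),
      withDensity_apply _ (hT hB), ← Measure.map_apply hT hB,
      ← Measure.setLIntegral_rnDeriv hac, setLIntegral_map hB hrm hT]
    rfl
  have hMac : M ≪ N := by
    rw [hMN]; exact withDensity_absolutelyContinuous _ _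
  have hllr : llr M N =ᵐ[M] llr (M.map T) (N.map T) ∘ T := by
    have h1 : M.rnDeriv N =ᵐ[N] r ∘ T := by
      nth_rw 1 [hMN]
      exact Measure.rnDeriv_withDensity N (hrm.comp hT)
    filter_upwards [hMac.ae_le h1] with z hz
    simp only [llr, Function.comp_apply, hz, hr]
  have hm : AEStronglyMeasurable (llr (M.map T) (N.map T)) (M.map T) :=
    (measurable_llr _ _).aestronglyMeasurable
  have hint : Integrable (llr M N) M ↔ Integrable (llr (M.map T) (N.map T)) (M.map T) := by
    rw [integrable_congr hllr, integrable_map_measure hm hT.aemeasurable]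
  have hval : ∫ z, llr M N z ∂M = ∫ u, llr (M.map T) (N.map T) u ∂M.map T := by
    rw [integral_congr_ae hllr, integral_map hT.aemeasurable hm]
    rfl
  simp only [klDiv, hMac, hac, hint, hval, true_and]

/-- The marginal cdf transforms of a pair of random vectors generate the Borel σ-algebra up to
null sets of a measure whose coordinates do not charge the flat parts of the cdfs. -/
lemma le_eventuallyMeasurableSpace_cdf {p q : ℕ} {F : Fin (p + q) → ℝ → ℝ}
    (hFm : ∀ i, Monotone (F i)) {κ : Measure ((Fin q → ℝ) × (Fin p → ℝ))}
    (hκ : ∀ i a, κ {z | a < Fin.append z.2 z.1 i ∧ F i (Fin.append z.2 z.1 i) ≤ F i a} = 0) :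
    (inferInstance : MeasurableSpace ((Fin q → ℝ) × (Fin p → ℝ))) ≤
      eventuallyMeasurableSpace (MeasurableSpace.comap
        (fun z i => F i (Fin.append z.2 z.1 i)) inferInstance) (ae κ) := by
  have hcoord : ∀ i, @Measurable _ _ (eventuallyMeasurableSpace (MeasurableSpace.comap
      (fun z : (Fin q → ℝ) × (Fin p → ℝ) => fun i => F i (Fin.append z.2 z.1 i)) inferInstance)
      (ae κ)) _ (fun z : (Fin q → ℝ) × (Fin p → ℝ) => Fin.append z.2 z.1 i) := by
    intro i
    have key : ∀ (m : MeasurableSpace ((Fin q → ℝ) × (Fin p → ℝ)))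
        (f : (Fin q → ℝ) × (Fin p → ℝ) → ℝ),
        (∀ a, MeasurableSet[m] (f ⁻¹' Iic a)) → Measurable[m] f := fun m f h =>
      measurable_of_Iic h
    refine key _ _ fun a => ?_
    refine ⟨_, ⟨{u | u i ≤ F i a}, measurableSet_le (measurable_pi_apply i) measurable_const, rfl⟩,
      ?_⟩
    filter_upwards [measure_eq_zero_iff_ae_notMem.1 (hκ i a)] with z hz
    refine propext ⟨fun h => hFm i h, fun h => ?_⟩
    by_contra hlt
    exact hz ⟨not_le.1 hlt, h⟩
  refine sup_le ?_ ?_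
  · rw [← measurable_iff_comap_le]
    refine @measurable_pi_lambda _ _ _ (_) _ _ fun j => ?_
    simpa using hcoord (Fin.natAdd p j)
  · rw [← measurable_iff_comap_le]
    refine @measurable_pi_lambda _ _ _ (_) _ _ fun j => ?_
    simpa using hcoord (Fin.castAdd q j)

/-- The mutual information of a pair of vectors with a joint density, in terms of entropies. -/
lemma klDiv_append_prod {p q : ℕ} {P : Measure (Fin (p + q) → ℝ)} [IsProbabilityMeasure P]
    (hP : P ≪ volume) (hPf : FiniteEnt P) {Px : Measure (Fin p → ℝ)} {Py : Measure (Fin q → ℝ)}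
    (hPx : Px = P.map fun u i => u (Fin.castAdd q i))
    (hPy : Py = P.map fun u j => u (Fin.natAdd p j))
    (hPxac : Px ≪ volume) (hPyac : Py ≪ volume) (hPxf : FiniteEnt Px) (hPyf : FiniteEnt Py) :
    P ≪ (Px.prod Py).map (fun z => Fin.append z.1 z.2) ∧
    klDiv P ((Px.prod Py).map fun z => Fin.append z.1 z.2)
      = ((diffEnt Px + diffEnt Py - diffEnt P : ℝ) : EReal) := by
  have hmx : Measurable fun (u : Fin (p + q) → ℝ) i => u (Fin.castAdd q i) := by fun_prop
  have hmy : Measurable fun (u : Fin (p + q) → ℝ) j => u (Fin.natAdd p j) := by fun_prop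
  have hprx : IsProbabilityMeasure Px := hPx ▸ Measure.isProbabilityMeasure_map hmx.aemeasurable
  have hpry : IsProbabilityMeasure Py := hPy ▸ Measure.isProbabilityMeasure_map hmy.aemeasurable
  set R := (Px.prod Py).map (fun z => Fin.append z.1 z.2) with hR
  have hprR : IsProbabilityMeasure R := Measure.isProbabilityMeasure_map measurable_append.aemeasurable
  set w : (Fin (p + q) → ℝ) → ℝ := fun u =>
    dens Px (fun i => u (Fin.castAdd q i)) * dens Py (fun j => u (Fin.natAdd p j)) with hw
  have hdx : Measurable (dens Px) := measurable_dens Px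
  have hdy : Measurable (dens Py) := measurable_dens Py
  have hwm : Measurable w := (hdx.comp hmx).mul (hdy.comp hmy)
  have hw0 : ∀ u, 0 ≤ w u := fun u => mul_nonneg (dens_nonneg _ _) (dens_nonneg _ _)
  have hRw : R = volume.withDensity fun u => ENNReal.ofReal (w u) := by
    ext s hs
    have hs' := measurable_append (p := p) (q := q) hs
    rw [hR, Measure.map_apply measurable_append hs, withDensity_apply _ hs]
    nth_rw 1 [← withDensity_dens hPxac, ← withDensity_dens hPyac]
    rw [prod_withDensity hdx.ennreal_ofReal hdy.ennreal_ofReal, withDensity_apply _ hs',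
      ← (measurePreserving_append p q).map_eq,
      setLIntegral_map hs hwm.ennreal_ofReal measurable_append]
    simp only [hw, Fin.append_left, Fin.append_right, ENNReal.ofReal_mul (dens_nonneg _ _)]
    rfl
  have hRd : dens R =ᵐ[volume] w := by
    rw [hRw]; exact dens_withDensity hwm hw0
  have hmpx : MeasurePreserving (fun u i => u (Fin.castAdd q i)) P Px := ⟨hmx, hPx.symm⟩
  have hmpy : MeasurePreserving (fun u j => u (Fin.natAdd p j)) P Py := ⟨hmy, hPy.symm⟩
  have hxpos : ∀ᵐ u ∂P, 0 < dens Px (fun i => u (Fin.castAdd q i)) :=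
    hmpx.quasiMeasurePreserving.ae (dens_pos_ae hPxac)
  have hypos : ∀ᵐ u ∂P, 0 < dens Py (fun j => u (Fin.natAdd p j)) :=
    hmpy.quasiMeasurePreserving.ae (dens_pos_ae hPyac)
  have hPR : P ≪ R := by
    refine Measure.AbsolutelyContinuous.mk fun s hs h0 => ?_
    rw [hRw, withDensity_apply _ hs, lintegral_eq_zero_iff hwm.ennreal_ofReal] at h0
    refine measure_eq_zero_iff_ae_notMem.2 ?_
    filter_upwards [hP.ae_le ((ae_restrict_iff' hs).1 h0), hxpos, hypos] with u h1 h2 h3 h4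
    have h5 := h1 h4
    simp only [Pi.zero_apply, ENNReal.ofReal_eq_zero] at h5
    exact absurd (mul_pos h2 h3) (not_lt.2 h5)
  refine ⟨hPR, ?_⟩
  have hllr : llr P R =ᵐ[P] fun u => Real.log (dens P u)
      - Real.log (dens Px fun i => u (Fin.castAdd q i))
      - Real.log (dens Py fun j => u (Fin.natAdd p j)) := by
    filter_upwards [hP.ae_le (Measure.rnDeriv_mul_rnDeriv (κ := volume) hPR), hP.ae_le hRd,
      dens_pos_ae hP, hxpos, hypos] with u h1 h2 h3 h4 h5
    have h6 : (P.rnDeriv R u).toReal * w u = dens P u := by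
      rw [← h2, dens, dens, ← h1, Pi.mul_apply, ENNReal.toReal_mul]
    rw [← h6] at h3
    rw [← h6, Real.log_mul (left_ne_zero_of_mul h3.ne') (right_ne_zero_of_mul h3.ne'), hw,
      Real.log_mul h4.ne' h5.ne', llr]
    ring
  have hi := hPf.integrable_log_dens hP
  have hix : Integrable (fun u => Real.log (dens Px fun i => u (Fin.castAdd q i))) P :=
    hmpx.integrable_comp_of_integrable (hPxf.integrable_log_dens hPxac)
  have hiy : Integrable (fun u => Real.log (dens Py fun j => u (Fin.natAdd p j))) P :=
    hmpy.integrable_comp_of_integrable (hPyf.integrable_log_dens hPyac)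
  have hvx : ∫ u, Real.log (dens Px fun i => u (Fin.castAdd q i)) ∂P = - diffEnt Px := by
    rw [← integral_log_dens hPxac, ← hmpx.map_eq, integral_map hmx.aemeasurable]
    exact (Real.measurable_log.comp (measurable_dens _)).aestronglyMeasurable
  have hvy : ∫ u, Real.log (dens Py fun j => u (Fin.natAdd p j)) ∂P = - diffEnt Py := by
    rw [← integral_log_dens hPyac, ← hmpy.map_eq, integral_map hmy.aemeasurable]
    exact (Real.measurable_log.comp (measurable_dens _)).aestronglyMeasurable
  rw [klDiv, if_pos ⟨hPR, ((hi.sub hix).sub hiy).congr hllr.symm⟩, integral_congr_ae hllr,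
    integral_sub (by exact hi.sub hix) hiy, integral_sub hi hix, hvx, hvy, integral_log_dens hP]
  congr 1
  ring

/-- Marginalizing onto a block of coordinates preserves absolute continuity. -/
lemma absolutelyContinuous_map_castAdd {p q : ℕ} {P : Measure (Fin (p + q) → ℝ)}
    (hP : P ≪ volume) : P.map (fun u (i : Fin p) => u (Fin.castAdd q i)) ≪ volume := by
  have hm : Measurable fun (u : Fin (p + q) → ℝ) (i : Fin p) => u (Fin.castAdd q i) := by fun_prop
  refine (hP.map hm).trans ?_
  rw [← (measurePreserving_append p q).map_eq, Measure.map_map hm measurable_append]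
  simp only [Function.comp_def, Fin.append_left]
  exact (Measure.quasiMeasurePreserving_fst (μ := (volume : Measure (Fin p → ℝ)))
      (ν := (volume : Measure (Fin q → ℝ)))).absolutelyContinuous

lemma absolutelyContinuous_map_natAdd {p q : ℕ} {P : Measure (Fin (p + q) → ℝ)}
    (hP : P ≪ volume) : P.map (fun u (j : Fin q) => u (Fin.natAdd p j)) ≪ volume := by
  have hm : Measurable fun (u : Fin (p + q) → ℝ) (j : Fin q) => u (Fin.natAdd p j) := by fun_prop
  refine (hP.map hm).trans ?_
  rw [← (measurePreserving_append p q).map_eq, Measure.map_map hm measurable_append]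
  simp only [Function.comp_def, Fin.append_right]
  exact (Measure.quasiMeasurePreserving_snd (μ := (volume : Measure (Fin p → ℝ)))
      (ν := (volume : Measure (Fin q → ℝ)))).absolutelyContinuous

lemma map_cube_eq_one {d : ℕ} {Ω : Type*} [MeasurableSpace Ω] {μ : Measure Ω}
    [IsProbabilityMeasure μ] {u : Ω → Fin d → ℝ} (hu : Measurable u)
    (h : ∀ ω i, u ω i ∈ Icc (0 : ℝ) 1) : μ.map u (Cube d) = 1 := by
  rw [Measure.map_apply hu (measurableSet_cube d),
    show u ⁻¹' Cube d = univ from eq_univ_of_forall fun ω i _ => h ω i, measure_univ]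

/-- Fundamental identity of the inductive approach (Corollary `ind_wins`):
the error of the maximum-entropy mutual information estimator is the sum of the KL errors on
the individual copulas minus the KL error on the joint copula. -/
theorem inductive_mi_error {p q qx qy qxy : ℕ} [NeZero qx] [NeZero qy] [NeZero qxy]
    {Ω : Type*} [MeasurableSpace Ω] (μ : Measure Ω) [IsProbabilityMeasure μ]
    (x : Ω → Fin p → ℝ) (y : Ω → Fin q → ℝ) (hx : Measurable x) (hy : Measurable y)
    -- the joint vector (x, y) has a pdf
    (hpdf : μ.map (fun ω => Fin.append (x ω) (y ω)) ≪ volume)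
    -- its marginal cdfs, assumed continuous
    (F : Fin (p + q) → ℝ → ℝ)
    (hF : ∀ i t, F i t
      = ((μ.map (fun ω => Fin.append (x ω) (y ω))).map (fun v => v i) (Set.Iic t)).toReal)
    (hFc : ∀ i, Continuous (F i))
    -- copula-uniform dual representations and their laws
    (ux : Ω → Fin p → ℝ) (hux : ∀ ω i, ux ω i = F (Fin.castAdd q i) (x ω i))
    (uy : Ω → Fin q → ℝ) (huy : ∀ ω j, uy ω j = F (Fin.natAdd p j) (y ω j))
    (uxy : Ω → Fin (p + q) → ℝ) (huxy : ∀ ω i, uxy ω i = F i (Fin.append (x ω) (y ω) i))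
    (hEx : FiniteEnt (μ.map ux)) (hEy : FiniteEnt (μ.map uy))
    (hExy : FiniteEnt (μ.map uxy))
    -- bounded continuous constraint functions with first coordinate 1
    (φx : (Fin p → ℝ) → Fin qx → ℝ) (hφxc : Continuous φx)
    (hφxb : ∃ C, ∀ u ∈ Cube p, ∀ j, |φx u j| ≤ C) (hφx1 : ∀ u, φx u 0 = 1)
    (φy : (Fin q → ℝ) → Fin qy → ℝ) (hφyc : Continuous φy)
    (hφyb : ∃ C, ∀ u ∈ Cube q, ∀ j, |φy u j| ≤ C) (hφy1 : ∀ u, φy u 0 = 1)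
    (φxy : (Fin (p + q) → ℝ) → Fin qxy → ℝ) (hφxyc : Continuous φxy)
    (hφxyb : ∃ C, ∀ u ∈ Cube (p + q), ∀ j, |φxy u j| ≤ C) (hφxy1 : ∀ u, φxy u 0 = 1)
    -- the three maximum-entropy distributions under the constraints inherited from the data
    (PAMx : Measure (Fin p → ℝ)) (hPAMx : IsProbabilityMeasure PAMx)
    (hPAMxac : PAMx ≪ volume) (hPAMxm : PAMx (Cube p) = 1)
    (hPAMxc : ∀ j, ∫ u, φx u j ∂PAMx = ∫ u, φx u j ∂(μ.map ux))
    (hPAMxfin : FiniteEnt PAMx)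
    (hPAMxmax : ∀ P : Measure (Fin p → ℝ), IsProbabilityMeasure P → P ≪ volume →
      P (Cube p) = 1 → (∀ j, ∫ u, φx u j ∂P = ∫ u, φx u j ∂(μ.map ux)) → FiniteEnt P →
      diffEnt P ≤ diffEnt PAMx)
    (PAMy : Measure (Fin q → ℝ)) (hPAMy : IsProbabilityMeasure PAMy)
    (hPAMyac : PAMy ≪ volume) (hPAMym : PAMy (Cube q) = 1)
    (hPAMyc : ∀ j, ∫ u, φy u j ∂PAMy = ∫ u, φy u j ∂(μ.map uy))
    (hPAMyfin : FiniteEnt PAMy)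
    (hPAMymax : ∀ P : Measure (Fin q → ℝ), IsProbabilityMeasure P → P ≪ volume →
      P (Cube q) = 1 → (∀ j, ∫ u, φy u j ∂P = ∫ u, φy u j ∂(μ.map uy)) → FiniteEnt P →
      diffEnt P ≤ diffEnt PAMy)
    (PAMxy : Measure (Fin (p + q) → ℝ)) (hPAMxy : IsProbabilityMeasure PAMxy)
    (hPAMxyac : PAMxy ≪ volume) (hPAMxym : PAMxy (Cube (p + q)) = 1)
    (hPAMxyc : ∀ j, ∫ u, φxy u j ∂PAMxy = ∫ u, φxy u j ∂(μ.map uxy))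
    (hPAMxyfin : FiniteEnt PAMxy)
    (hPAMxymax : ∀ P : Measure (Fin (p + q) → ℝ), IsProbabilityMeasure P → P ≪ volume →
      P (Cube (p + q)) = 1 →
      (∀ j, ∫ u, φxy u j ∂P = ∫ u, φxy u j ∂(μ.map uxy)) → FiniteEnt P →
      diffEnt P ≤ diffEnt PAMxy) :
    ((diffEnt PAMx + diffEnt PAMy - diffEnt PAMxy : ℝ) : EReal)
        - klDiv (μ.map fun ω => (y ω, x ω)) ((μ.map y).prod (μ.map x))
      = klDiv (μ.map ux) PAMx + klDiv (μ.map uy) PAMy - klDiv (μ.map uxy) PAMxy := by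
  have hxy : Measurable fun ω => Fin.append (x ω) (y ω) := measurable_append.comp (hx.prodMk hy)
  have hν : IsProbabilityMeasure (μ.map fun ω => Fin.append (x ω) (y ω)) :=
    Measure.isProbabilityMeasure_map hxy.aemeasurable
  have hρ : ∀ i, IsProbabilityMeasure
      ((μ.map fun ω => Fin.append (x ω) (y ω)).map fun v : Fin (p + q) → ℝ => v i) := fun i =>
    Measure.isProbabilityMeasure_map (measurable_pi_apply i).aemeasurable
  have hF01 : ∀ i t, F i t ∈ Icc (0 : ℝ) 1 := fun i t => cdf_mem_Icc (hF i) t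
  have hFm : ∀ i, Monotone (F i) := fun i => monotone_of_cdf (hF i)
  have hFmeas : ∀ i, Measurable (F i) := fun i => (hFc i).measurable
  have hTx : Measurable fun (v : Fin p → ℝ) i => F (Fin.castAdd q i) (v i) := by fun_prop
  have hTy : Measurable fun (v : Fin q → ℝ) j => F (Fin.natAdd p j) (v j) := by fun_prop
  have hTxy : Measurable fun (v : Fin (p + q) → ℝ) i => F i (v i) := by fun_prop
  obtain rfl : ux = fun ω i => F (Fin.castAdd q i) (x ω i) := funext fun ω => funext (hux ω)
  obtain rfl : uy = fun ω j => F (Fin.natAdd p j) (y ω j) := funext fun ω => funext (huy ω)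
  obtain rfl : uxy = fun ω i => F i (Fin.append (x ω) (y ω) i) :=
    funext fun ω => funext (huxy ω)
  have hux_meas := hTx.comp hx
  have huy_meas := hTy.comp hy
  have huxy_meas : Measurable fun ω i => F i (Fin.append (x ω) (y ω) i) := hTxy.comp hxy
  set P := μ.map fun ω i => F i (Fin.append (x ω) (y ω) i) with hPdef
  set Px := μ.map fun ω i => F (Fin.castAdd q i) (x ω i) with hPxdef
  set Py := μ.map fun ω j => F (Fin.natAdd p j) (y ω j) with hPydef
  have hPprob : IsProbabilityMeasure P :=
    Measure.isProbabilityMeasure_map huxy_meas.aemeasurable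
  have hPxprob : IsProbabilityMeasure Px :=
    Measure.isProbabilityMeasure_map hux_meas.aemeasurable
  have hPyprob : IsProbabilityMeasure Py :=
    Measure.isProbabilityMeasure_map huy_meas.aemeasurable
  have hPac : P ≪ volume := by
    have := map_cdf_absolutelyContinuous hpdf hF hFc
    rwa [Measure.map_map hTxy hxy] at this
  have hPx : Px = P.map fun u i => u (Fin.castAdd q i) := by
    rw [hPdef, Measure.map_map (by fun_prop) huxy_meas]
    simp only [Function.comp_def, Fin.append_left, hPxdef]
  have hPy : Py = P.map fun u j => u (Fin.natAdd p j) := by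
    rw [hPdef, Measure.map_map (by fun_prop) huxy_meas]
    simp only [Function.comp_def, Fin.append_right, hPydef]
  have hPxac : Px ≪ volume := hPx ▸ absolutelyContinuous_map_castAdd hPac
  have hPyac : Py ≪ volume := hPy ▸ absolutelyContinuous_map_natAdd hPac
  have hklx : klDiv Px PAMx = ((diffEnt PAMx - diffEnt Px : ℝ) : EReal) :=
    IsMaxEnt.klDiv_eq ⟨hPAMx, hPAMxac, hPAMxm, hPAMxc, hPAMxfin, hPAMxmax⟩ hPxac
      (map_cube_eq_one hux_meas fun ω i => hF01 _ _) hEx hφxc hφxb ⟨0, hφx1⟩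
  have hkly : klDiv Py PAMy = ((diffEnt PAMy - diffEnt Py : ℝ) : EReal) :=
    IsMaxEnt.klDiv_eq ⟨hPAMy, hPAMyac, hPAMym, hPAMyc, hPAMyfin, hPAMymax⟩ hPyac
      (map_cube_eq_one huy_meas fun ω j => hF01 _ _) hEy hφyc hφyb ⟨0, hφy1⟩
  have hklxy : klDiv P PAMxy = ((diffEnt PAMxy - diffEnt P : ℝ) : EReal) :=
    IsMaxEnt.klDiv_eq ⟨hPAMxy, hPAMxyac, hPAMxym, hPAMxyc, hPAMxyfin, hPAMxymax⟩ hPac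
      (map_cube_eq_one huxy_meas fun ω i => hF01 _ _) hExy hφxyc hφxyb ⟨0, hφxy1⟩
  have hxprob : IsProbabilityMeasure (μ.map x) :=
    Measure.isProbabilityMeasure_map hx.aemeasurable
  have hyprob : IsProbabilityMeasure (μ.map y) :=
    Measure.isProbabilityMeasure_map hy.aemeasurable
  have hyx : Measurable fun ω => (y ω, x ω) := hy.prodMk hx
  have hyxprob : IsProbabilityMeasure (μ.map fun ω => (y ω, x ω)) :=
    Measure.isProbabilityMeasure_map hyx.aemeasurable
  have happ : Measurable fun z : (Fin q → ℝ) × (Fin p → ℝ) => Fin.append z.2 z.1 :=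
    measurable_append.comp measurable_swap
  have hT : Measurable fun (z : (Fin q → ℝ) × (Fin p → ℝ)) i => F i (Fin.append z.2 z.1 i) :=
    hTxy.comp happ
  have hMT : (μ.map fun ω => (y ω, x ω)).map
      (fun z i => F i (Fin.append z.2 z.1 i)) = P := Measure.map_map hT hyx
  have hNT : ((μ.map y).prod (μ.map x)).map (fun z i => F i (Fin.append z.2 z.1 i)) =
      (Px.prod Py).map fun z => Fin.append z.1 z.2 := by
    have h1 : Px = (μ.map x).map fun v i => F (Fin.castAdd q i) (v i) :=
      (Measure.map_map hTx hx).symm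
    have h2 : Py = (μ.map y).map fun v j => F (Fin.natAdd p j) (v j) :=
      (Measure.map_map hTy hy).symm
    rw [h1, h2, Measure.map_prod_map _ _ hTx hTy, ← Measure.prod_swap,
      Measure.map_map hT measurable_swap,
      Measure.map_map measurable_append (hTx.prodMap hTy)]
    congr 1
    ext z i
    refine Fin.addCases (fun i => ?_) (fun j => ?_) i <;> simp
  have hMN : ∀ i, ((μ.map fun ω => (y ω, x ω)).map fun z => Fin.append z.2 z.1 i) =
      (μ.map fun ω => Fin.append (x ω) (y ω)).map (fun v => v i) ∧
      (((μ.map y).prod (μ.map x)).map fun z => Fin.append z.2 z.1 i) =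
      (μ.map fun ω => Fin.append (x ω) (y ω)).map (fun v => v i) := by
    intro i
    have hmi : Measurable fun z : (Fin q → ℝ) × (Fin p → ℝ) => Fin.append z.2 z.1 i :=
      (measurable_pi_apply i).comp happ
    rw [Measure.map_map (measurable_pi_apply i) hxy]
    refine ⟨Measure.map_map hmi hyx, ?_⟩
    refine Fin.addCases (fun i => ?_) (fun j => ?_) i
    · simp only [Function.comp_def, Fin.append_left]
      have h := Measure.map_map (measurable_pi_apply i) measurable_snd
        (μ := (μ.map y).prod (μ.map x))
      rw [(measurePreserving_snd (μ := μ.map y) (ν := μ.map x)).map_eq,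
        Measure.map_map (measurable_pi_apply i) hx] at h
      exact h.symm
    · simp only [Function.comp_def, Fin.append_right]
      have h := Measure.map_map (measurable_pi_apply j) measurable_fst
        (μ := (μ.map y).prod (μ.map x))
      rw [(measurePreserving_fst (μ := μ.map y) (ν := μ.map x)).map_eq,
        Measure.map_map (measurable_pi_apply j) hy] at h
      exact h.symm
  have hκ : ∀ i a, ((μ.map fun ω => (y ω, x ω)) + (μ.map y).prod (μ.map x))
      {z | a < Fin.append z.2 z.1 i ∧ F i (Fin.append z.2 z.1 i) ≤ F i a} = 0 := by
    intro i a
    have hms : MeasurableSet {t | a < t ∧ F i t ≤ F i a} :=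
      measurableSet_Ioi.inter (measurableSet_le (hFmeas i) measurable_const)
    have hmi : Measurable fun z : (Fin q → ℝ) × (Fin p → ℝ) => Fin.append z.2 z.1 i :=
      (measurable_pi_apply i).comp happ
    have h0 := measure_flat_cdf (hF i) a
    have h1 := h0
    rw [← (hMN i).1, Measure.map_apply hmi hms] at h0
    rw [← (hMN i).2, Measure.map_apply hmi hms] at h1
    rw [Measure.add_apply, add_eq_zero]
    exact ⟨h0, h1⟩
  obtain ⟨hPR, hMI⟩ := klDiv_append_prod hPac hExy hPx hPy hPxac hPyac hEx hEy
  rw [klDiv_map_of_generating hT (le_eventuallyMeasurableSpace_cdf hFm hκ)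
    (by rw [hMT, hNT]; exact hPR), hMT, hNT, hMI, hklx, hkly, hklxy, ← EReal.coe_sub,
    ← EReal.coe_add, ← EReal.coe_sub]
  congr 1
  ring
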